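/- Let K be a field, S a positive normal affine semigroup with gp(S) = ℤ^r, R = K[S], and 𝔪 the maximal ideal of R generated by all nonunit monomials. Let λ be the maximal length of a sequence of monomials in 𝔪 that is a regular sequence on R. Then λ equals the maximal number ℓ for which there exist subsets 𝓕_1,…,𝓕_ℓ of the set 𝓕 = {F_1,…,F_s} of facets of C(S) satisfying: (i) 𝓕_i ∩ 𝓕_j = ∅ for all i ≠ j, and (ii) ⋂_{F ∈ 𝓕∖𝓕_i} F ≠ {0} for every i. -/

import Mathlib

set_option synthInstance.maxHeartbeats 1000000
set_option maxHeartbeats 1000000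

open scoped BigOperators

noncomputable section

/-- Pairing of an integral linear form (given by its coefficient vector `f`) with `x`. -/
def lin {r : ℕ} (f x : Fin r → ℤ) : ℤ := ∑ k, f k * x k

lemma lin_zero {r : ℕ} (f : Fin r → ℤ) : lin f 0 = 0 := by simp [lin]

lemma lin_add {r : ℕ} (f x y : Fin r → ℤ) : lin f (x + y) = lin f x + lin f y := by
  simp [lin, mul_add, Finset.sum_add_distrib]

/-- A family of integral linear forms, bundled as an additive homomorphism `ℤ^r → ℤ^s`. -/
def formsHom {r s : ℕ} (σ : Fin s → Fin r → ℤ) : (Fin r → ℤ) →+ (Fin s → ℤ) where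
  toFun x i := lin (σ i) x
  map_zero' := by funext i; simp [lin_zero]
  map_add' x y := by funext i; simp [lin_add]

/-- The subgroup `σ(ℤ^r) ⊆ ℤ^s`. -/
def formsRange {r s : ℕ} (σ : Fin s → Fin r → ℤ) : AddSubgroup (Fin s → ℤ) :=
  (formsHom σ).range

/-- The divisor class group `Cl(R) = ℤ^s / σ(ℤ^r)`. -/
abbrev classGroup {r s : ℕ} (σ : Fin s → Fin r → ℤ) : Type :=
  (Fin s → ℤ) ⧸ formsRange σ

/-- The set of solutions of the inhomogeneous system of inequalities `σ_i(x) ≥ a_i`. -/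
def Tset {r s : ℕ} (σ : Fin s → Fin r → ℤ) (a : Fin s → ℤ) : Set (Fin r → ℤ) :=
  {x | ∀ i, a i ≤ lin (σ i) x}

/-- The monomial of exponent `x` in the group algebra `K[ℤ^r]`. -/
def mono (K : Type*) [Field K] {r : ℕ} (x : Fin r → ℤ) : AddMonoidAlgebra K (Fin r → ℤ) :=
  AddMonoidAlgebra.single x 1

/-- The affine semigroup ring `K[S]`, as a subalgebra of `K[ℤ^r]`. -/
def semigroupRing (K : Type*) [Field K] {r : ℕ} (S : AddSubmonoid (Fin r → ℤ)) :
    Subalgebra K (AddMonoidAlgebra K (Fin r → ℤ)) :=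
  Algebra.adjoin K {f | ∃ x ∈ S, f = mono K x}

/-- The monomial (fractional) ideal of `K[S]` with monomial basis `T ⊆ ℤ^r`, as a
`K[S]`-submodule of `K[ℤ^r]`.  (When `S + T ⊆ T`, its underlying set is the `K`-span
of the monomials with exponents in `T`.) -/
def monIdeal (K : Type*) [Field K] {r : ℕ} (S : AddSubmonoid (Fin r → ℤ))
    (T : Set (Fin r → ℤ)) :
    Submodule ↥(semigroupRing K S) (AddMonoidAlgebra K (Fin r → ℤ)) :=
  Submodule.span _ {f | ∃ x ∈ T, f = mono K x}

/-- The maximal ideal of `K[S]` generated by all nonunit monomials. -/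
def irrelevantIdeal (K : Type*) [Field K] {r : ℕ} (S : AddSubmonoid (Fin r → ℤ)) :
    Ideal ↥(semigroupRing K S) :=
  Ideal.span {f | ∃ x ∈ S, x ≠ 0 ∧ (f : AddMonoidAlgebra K (Fin r → ℤ)) = mono K x}

/-- `M` is a Cohen–Macaulay module with respect to the ideal `I ⊆ R`: the length of a
maximal `M`-regular sequence contained in `I` equals the Krull dimension of `M`
(the Krull dimension of `R/ann(M)`). -/
def IsCohenMacaulayMod (R : Type*) [CommRing R] (I : Ideal R)
    (M : Type*) [AddCommGroup M] [Module R M] : Prop :=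
  ∃ rs : List R, (∀ x ∈ rs, x ∈ I) ∧ RingTheory.Sequence.IsRegular M rs ∧
    (∀ y ∈ I, ¬ RingTheory.Sequence.IsRegular M (rs ++ [y])) ∧
    (rs.length : WithBot ℕ∞) = ringKrullDim (R ⧸ Module.annihilator R M)

/-- The cone `C(S) ⊆ ℝ^r` generated by a set `Sset ⊆ ℤ^r`: all finite linear combinations
of elements of `Sset` with nonnegative real coefficients. -/
def coneOf {r : ℕ} (Sset : Set (Fin r → ℤ)) : Set (Fin r → ℝ) :=
  {x | ∃ (t : Finset (Fin r → ℤ)) (c : (Fin r → ℤ) → ℝ),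
    (↑t : Set (Fin r → ℤ)) ⊆ Sset ∧ (∀ v, 0 ≤ c v) ∧
    x = ∑ v ∈ t, c v • (fun k => (v k : ℝ))}

/-! ### Regular sequences in a commutative monoid -/

section Monoid

variable {M : Type*} [AddCommMonoid M]

/-- The ideal `A + M` of the monoid `M` generated by `A`. -/
def monoidIdeal (A : Set M) : Set M := {z | ∃ x ∈ A, ∃ t, z = x + t}

/-- `y` is a nonzerodivisor modulo the monoid ideal generated by `A`. -/
def RegularMod (A : Set M) (y : M) : Prop :=
  ∀ z, y + z ∈ monoidIdeal A → z ∈ monoidIdeal A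

/-- A list of monoid elements is a regular sequence modulo the ideal generated by `A`. -/
def RegularSeqMod : Set M → List M → Prop
  | _, [] => True
  | A, y :: L => RegularMod A y ∧ RegularSeqMod (insert y A) L

lemma monoidIdeal_mono {A B : Set M} (h : A ⊆ B) : monoidIdeal A ⊆ monoidIdeal B :=
  fun _ ⟨x, hx, t, ht⟩ => ⟨x, h hx, t, ht⟩

lemma add_mem_monoidIdeal {A : Set M} (y : M) {z : M} (hz : z ∈ monoidIdeal A) :
    y + z ∈ monoidIdeal A := by
  obtain ⟨x, hx, t, rfl⟩ := hz
  exact ⟨x, hx, y + t, add_left_comm _ _ _⟩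

lemma mem_monoidIdeal_insert {A : Set M} {x z : M} :
    z ∈ monoidIdeal (insert x A) ↔ (∃ t, z = x + t) ∨ z ∈ monoidIdeal A := by
  simp [monoidIdeal]

lemma RegularMod.of_insert {A : Set M} {x y : M} (d : M → ℕ) (hd : ∀ z, d z < d (x + z))
    (hx : RegularMod A x) (hy : RegularMod (insert x A) y) : RegularMod A y := by
  intro z
  induction hn : d z using Nat.strong_induction_on generalizing z with
  | _ n ih =>
    subst hn
    intro hz
    rcases mem_monoidIdeal_insert.1 (hy z (monoidIdeal_mono (Set.subset_insert x A) hz)) with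
      ⟨t, rfl⟩ | h
    · rw [add_left_comm] at hz
      exact add_mem_monoidIdeal x (ih _ (hd t) t rfl (hx _ hz))
    · exact h

lemma RegularMod.insert_right [IsLeftCancelAdd M] {A : Set M} {x y : M}
    (hx : RegularMod A x) (hy : RegularMod (insert x A) y) : RegularMod (insert y A) x := by
  intro z hz
  rw [mem_monoidIdeal_insert] at hz ⊢
  rcases hz with ⟨t, ht⟩ | hz
  · rcases mem_monoidIdeal_insert.1 (hy t (mem_monoidIdeal_insert.2 (Or.inl ⟨z, ht.symm⟩))) with
      ⟨u, rfl⟩ | h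
    · rw [add_left_comm] at ht
      exact Or.inl ⟨u, add_left_cancel ht⟩
    · exact Or.inr (hx _ (ht ▸ add_mem_monoidIdeal y h))
  · exact Or.inr (hx _ hz)

lemma RegularSeqMod.tail [IsLeftCancelAdd M] (d : M → ℕ) {x : M} (hd : ∀ z, d z < d (x + z))
    {A : Set M} {L : List M} (h : RegularSeqMod A (x :: L)) : RegularSeqMod A L := by
  induction L generalizing A with
  | nil => trivial
  | cons y L ih =>
    obtain ⟨hx, hy, hL⟩ := h
    refine ⟨hx.of_insert d hd hy, ih ⟨hx.insert_right hy, ?_⟩⟩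
    rwa [Set.insert_comm]

lemma RegularSeqMod.regularMod [IsLeftCancelAdd M] (d : M → ℕ) {A : Set M} {L : List M}
    (hd : ∀ x ∈ L, ∀ z, d z < d (x + z)) (h : RegularSeqMod A L) : ∀ y ∈ L, RegularMod A y := by
  induction L with
  | nil => simp
  | cons x L ih =>
    rintro y (_ | ⟨_, hy⟩)
    · exact h.1
    · exact ih (fun x hx => hd x (List.mem_cons_of_mem _ hx))
        (h.tail d (hd x List.mem_cons_self)) y hy

lemma RegularSeqMod.pairwise [IsLeftCancelAdd M] (d : M → ℕ) {L : List M}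
    (hd : ∀ x ∈ L, ∀ z, d z < d (x + z)) (h : RegularSeqMod ∅ L) :
    L.Pairwise fun x y => RegularMod {x} y := by
  induction L with
  | nil => exact List.Pairwise.nil
  | cons x L ih =>
    have hd' : ∀ x ∈ L, ∀ z, d z < d (x + z) := fun x hx => hd x (List.mem_cons_of_mem _ hx)
    refine List.Pairwise.cons (fun y hy => ?_) (ih hd' (h.tail d (hd x List.mem_cons_self)))
    have := h.2.regularMod d hd' y hy
    rwa [insert_empty_eq] at this

lemma regularMod_of_forall_singleton {A : Set M} {y : M} (h : ∀ x ∈ A, RegularMod {x} y) :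
    RegularMod A y := by
  rintro z ⟨x, hx, t, ht⟩
  obtain ⟨x', rfl, t', ht'⟩ := h x hx z ⟨x, rfl, t, ht⟩
  exact ⟨_, hx, t', ht'⟩

lemma regularSeqMod_of_pairwise {A : Set M} {L : List M}
    (hA : ∀ x ∈ A, ∀ y ∈ L, RegularMod {x} y) (h : L.Pairwise fun x y => RegularMod {x} y) :
    RegularSeqMod A L := by
  induction L generalizing A with
  | nil => trivial
  | cons x L ih =>
    rw [List.pairwise_cons] at h
    refine ⟨regularMod_of_forall_singleton fun a ha => hA a ha x List.mem_cons_self,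
      ih ?_ h.2⟩
    rintro a (rfl | ha) y hy
    · exact h.1 y hy
    · exact hA a ha y (List.mem_cons_of_mem _ hy)

lemma regularSeqMod_iff_take {A : Set M} {L : List M} :
    RegularSeqMod A L ↔ ∀ i (h : i < L.length), RegularMod (A ∪ {x | x ∈ L.take i}) L[i] := by
  induction L generalizing A with
  | nil => simp [RegularSeqMod]
  | cons x L ih =>
    have key (i : ℕ) : A ∪ {y | y ∈ (x :: L).take (i + 1)} = insert x A ∪ {y | y ∈ L.take i} := by
      ext y
      simp only [List.take_succ_cons, List.mem_cons, Set.mem_union, Set.mem_ofPred_eq,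
        Set.mem_insert_iff]
      tauto
    rw [RegularSeqMod, ih]
    constructor
    · rintro ⟨h0, h1⟩ i hi
      cases i with
      | zero => simpa using h0
      | succ i => simpa only [key, List.getElem_cons_succ] using h1 i (by simpa using hi)
    · intro h
      refine ⟨?_, fun i hi => ?_⟩
      · have := h 0 (Nat.succ_pos _)
        rw [List.getElem_cons_zero] at this
        simpa using this
      · have := h (i + 1) (Nat.succ_lt_succ hi)
        rwa [key, List.getElem_cons_succ] at this

end Monoid

/-! ### Monomial ideals of a semigroup ring -/

section Monomial

variable (K : Type*) [Field K] {r : ℕ} {S : AddSubmonoid (Fin r → ℤ)}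

/-- The monomial with exponent in `S`, as an element of `K[S]`. -/
def semigroupMono (x : S) : semigroupRing K S :=
  ⟨mono K x, Algebra.subset_adjoin ⟨x, x.2, rfl⟩⟩

lemma mono_add (x y : Fin r → ℤ) : mono K (x + y) = mono K x * mono K y := by
  simp [mono, AddMonoidAlgebra.single_mul_single]

lemma semigroupMono_add (x y : S) :
    semigroupMono K (x + y) = semigroupMono K x * semigroupMono K y :=
  Subtype.ext (mono_add K _ _)

lemma semigroupMono_zero : semigroupMono K (0 : S) = 1 := rfl

variable {K}

lemma exists_add_of_coeff_mul_ne_zero {f g : AddMonoidAlgebra K (Fin r → ℤ)} {z : Fin r → ℤ}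
    (h : (f * g).coeff z ≠ 0) : ∃ a b, f.coeff a ≠ 0 ∧ g.coeff b ≠ 0 ∧ a + b = z := by
  have := AddMonoidAlgebra.support_coeff_mul_subset f g (Finsupp.mem_support_iff.2 h)
  obtain ⟨a, ha, b, hb, hab⟩ := Finset.mem_add.1 this
  exact ⟨a, b, Finsupp.mem_support_iff.1 ha, Finsupp.mem_support_iff.1 hb, hab⟩

lemma mem_of_coeff_mono_ne_zero {x z : Fin r → ℤ} (h : (mono K x).coeff z ≠ 0) : z = x := by
  by_contra hne
  exact h (by simp [mono, Ne.symm hne])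

lemma coeff_mono_self (x : Fin r → ℤ) : (mono K x).coeff x = 1 := by
  simp [mono]

lemma mem_of_coeff_ne_zero {f : AddMonoidAlgebra K (Fin r → ℤ)} (hf : f ∈ semigroupRing K S)
    {z : Fin r → ℤ} (hz : f.coeff z ≠ 0) : z ∈ S := by
  induction hf using Algebra.adjoin_induction generalizing z with
  | mem f h =>
    obtain ⟨x, hx, rfl⟩ := h
    rwa [mem_of_coeff_mono_ne_zero hz]
  | algebraMap c =>
    rcases eq_or_ne z 0 with rfl | h
    · exact S.zero_mem
    · simp [AddMonoidAlgebra.coe_algebraMap, h.symm] at hz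
  | add f g _ _ hf hg =>
    by_cases h : f.coeff z = 0
    · exact hg (by simpa [h] using hz)
    · exact hf h
  | mul f g _ _ hf hg =>
    obtain ⟨a, b, ha, hb, rfl⟩ := exists_add_of_coeff_mul_ne_zero hz
    exact S.add_mem (hf ha) (hg hb)

lemma mem_span_semigroupMono_iff {A : Set S} {f : semigroupRing K S} :
    f ∈ Ideal.span (semigroupMono K '' A) ↔
      ∀ z : S, (f : AddMonoidAlgebra K (Fin r → ℤ)).coeff z ≠ 0 → z ∈ monoidIdeal A := by
  constructor
  · intro hf
    induction hf using Submodule.span_induction with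
    | mem f h =>
      obtain ⟨x, hx, rfl⟩ := h
      intro z hz
      exact ⟨x, hx, 0, by simpa using Subtype.ext (mem_of_coeff_mono_ne_zero hz)⟩
    | zero => simp
    | add f g _ _ hf hg =>
      intro z hz
      by_cases h : (f : AddMonoidAlgebra K (Fin r → ℤ)).coeff z = 0
      · exact hg z (by simpa [h] using hz)
      · exact hf z h
    | smul a f _ hf =>
      intro z hz
      obtain ⟨p, q, hp, hq, hpq⟩ := exists_add_of_coeff_mul_ne_zero hz
      have hpS := mem_of_coeff_ne_zero a.2 hp
      have hqS := mem_of_coeff_ne_zero f.2 hq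
      have : z = ⟨p, hpS⟩ + ⟨q, hqS⟩ := Subtype.ext hpq.symm
      rw [this]
      exact add_mem_monoidIdeal _ (hf ⟨q, hqS⟩ hq)
  · intro h
    set F := (f : AddMonoidAlgebra K (Fin r → ℤ)) with hF
    have hsum : f = ∑ z ∈ F.coeff.support.attach,
        F.coeff z.1 • semigroupMono K
          ⟨z.1, mem_of_coeff_ne_zero f.2 (Finsupp.mem_support_iff.1 z.2)⟩ := by
      apply Subtype.ext
      rw [AddSubmonoidClass.coe_finsetSum]
      change F = ∑ z ∈ F.coeff.support.attach, F.coeff z.1 • mono K z.1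
      rw [Finset.sum_attach F.coeff.support (fun z => F.coeff z • mono K z)]
      apply AddMonoidAlgebra.coeff_injective
      ext y
      simp [mono, Finsupp.single_apply]
    rw [hsum]
    refine Ideal.sum_mem _ fun z _ => ?_
    have hz := Finsupp.mem_support_iff.1 z.2
    obtain ⟨x, hx, t, ht⟩ := h ⟨z.1, mem_of_coeff_ne_zero f.2 hz⟩ hz
    rw [ht, semigroupMono_add]
    exact Submodule.smul_of_tower_mem _ _
      (Ideal.mul_mem_right _ _ (Ideal.subset_span ⟨x, hx, rfl⟩))

lemma forall_mem_span_of_smul_mem_iff_regularMod {A : Set S} {y : S} :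
    (∀ g : semigroupRing K S, semigroupMono K y • g ∈ Ideal.span (semigroupMono K '' A) →
      g ∈ Ideal.span (semigroupMono K '' A)) ↔ RegularMod A y := by
  simp only [mem_span_semigroupMono_iff, smul_eq_mul]
  constructor
  · intro h z hz
    refine h (semigroupMono K z) (fun w hw => ?_) z ?_
    · rw [← semigroupMono_add] at hw
      rwa [Subtype.ext (mem_of_coeff_mono_ne_zero hw)]
    · exact (coeff_mono_self (K := K) (z : Fin r → ℤ)).trans_ne one_ne_zero
  · intro h g hg z hz
    refine h z (hg (y + z) ?_)
    simpa [semigroupMono, mono] using hz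

lemma isRegular_map_semigroupMono_iff (hS : ∀ x ∈ S, -x ∈ S → x = 0) {L : List S}
    (hL : ∀ x ∈ L, x ≠ 0) :
    RingTheory.Sequence.IsRegular (semigroupRing K S) (L.map (semigroupMono K)) ↔
      RegularSeqMod ∅ L := by
  have hideal (L : List S) : (Ideal.ofList (L.map (semigroupMono K)) • ⊤ :
      Ideal (semigroupRing K S)) = Ideal.span (semigroupMono K '' {x | x ∈ L}) := by
    rw [smul_eq_mul, Ideal.mul_top, Ideal.ofList]
    congr 1
    ext f
    simp
  have hweak : RingTheory.Sequence.IsWeaklyRegular (semigroupRing K S)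
      (L.map (semigroupMono K)) ↔ RegularSeqMod ∅ L := by
    rw [regularSeqMod_iff_take, RingTheory.Sequence.isWeaklyRegular_iff]
    simp only [List.length_map, Set.empty_union, List.getElem_map]
    refine forall₂_congr fun i hi => ?_
    rw [isSMulRegular_quotient_iff_mem_of_smul_mem, ← List.map_take, hideal]
    exact forall_mem_span_of_smul_mem_iff_regularMod
  rw [RingTheory.Sequence.isRegular_iff, hweak, and_iff_left_iff_imp]
  intro _ htop
  rw [hideal] at htop
  have h1 : (1 : semigroupRing K S) ∈ Ideal.span (semigroupMono K '' {x | x ∈ L}) :=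
    htop ▸ Submodule.mem_top
  rw [mem_span_semigroupMono_iff, ← semigroupMono_zero] at h1
  obtain ⟨x, hx, t, ht⟩ := h1 0 ((coeff_mono_self (K := K) 0).trans_ne one_ne_zero)
  have hneg : -(x : Fin r → ℤ) = t :=
    neg_eq_of_add_eq_zero_right (congrArg Subtype.val ht).symm
  exact hL x hx (Subtype.ext (hS x x.2 (hneg ▸ t.2)))

end Monomial

/-! ### Supports of monomials -/

section Forms

variable {r s : ℕ} {S : AddSubmonoid (Fin r → ℤ)} {σ : Fin s → Fin r → ℤ}

lemma lin_smul (f x : Fin r → ℤ) (n : ℤ) : lin f (n • x) = n * lin f x := by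
  simp [lin, Finset.mul_sum, mul_left_comm]

lemma lin_neg (f x : Fin r → ℤ) : lin f (-x) = -lin f x := by
  simp [lin]

lemma lin_sub (f x y : Fin r → ℤ) : lin f (x - y) = lin f x - lin f y := by
  rw [sub_eq_add_neg, lin_add, lin_neg, sub_eq_add_neg]

lemma lin_sum {ι : Type*} (f : Fin r → ℤ) (t : Finset ι) (x : ι → Fin r → ℤ) :
    lin f (∑ i ∈ t, x i) = ∑ i ∈ t, lin f (x i) := by
  classical
  induction t using Finset.induction_on with
  | empty => simp [lin_zero]
  | insert a t ha ih => rw [Finset.sum_insert ha, Finset.sum_insert ha, lin_add, ih]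

lemma exists_lin_eq_one {f : Fin r → ℤ} (hf : Finset.univ.gcd f = 1) : ∃ x, lin f x = 1 := by
  obtain ⟨c, hc⟩ := Finset.gcd_eq_sum_mul Finset.univ f
  exact ⟨c, by rw [lin, ← hc, hf]⟩

lemma eq_zero_of_forall_lin_eq_zero (hSpos : ∀ x ∈ S, -x ∈ S → x = 0)
    (hrep : ∀ x : Fin r → ℤ, x ∈ S ↔ ∀ i, 0 ≤ lin (σ i) x) {x : Fin r → ℤ}
    (hx : ∀ i, lin (σ i) x = 0) : x = 0 :=
  hSpos x ((hrep x).2 fun i => (hx i).ge) ((hrep _).2 fun i => by simp [lin_neg, hx i])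

/-- There is an element of `S` in the interior of the cone. -/
lemma exists_forall_lin_pos (hSgp : ∀ x : Fin r → ℤ, ∃ a ∈ S, ∃ b ∈ S, x = a - b)
    (hrep : ∀ x : Fin r → ℤ, x ∈ S ↔ ∀ i, 0 ≤ lin (σ i) x)
    (hprim : ∀ i, Finset.univ.gcd (σ i) = 1) : ∃ y, ∀ i, 0 < lin (σ i) y := by
  have h (i : Fin s) : ∃ y ∈ S, 0 < lin (σ i) y := by
    obtain ⟨u, hu⟩ := exists_lin_eq_one (hprim i)
    obtain ⟨a, ha, b, hb, rfl⟩ := hSgp u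
    refine ⟨a, ha, ?_⟩
    have := (hrep b).1 hb i
    rw [lin_sub] at hu
    omega
  choose y hyS hy using h
  refine ⟨∑ i, y i, fun i => ?_⟩
  rw [lin_sum]
  exact Finset.sum_pos' (fun j _ => (hrep _).1 (hyS j) i) ⟨i, Finset.mem_univ i, hy i⟩

/-- There is an integral point in the relative interior of each facet. -/
lemma exists_lin_eq_zero_forall_ne_pos {j : Fin s} (hpos : ∃ y, ∀ i, 0 < lin (σ i) y)
    (hirr : ∃ x : Fin r → ℤ, lin (σ j) x < 0 ∧ ∀ i, i ≠ j → 0 ≤ lin (σ i) x) :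
    ∃ w, lin (σ j) w = 0 ∧ ∀ i, i ≠ j → 0 < lin (σ i) w := by
  obtain ⟨y, hy⟩ := hpos
  obtain ⟨x, hxj, hx⟩ := hirr
  refine ⟨lin (σ j) y • x + (-lin (σ j) x) • y, ?_, fun i hi => ?_⟩
  · rw [lin_add, lin_smul, lin_smul]
    ring
  · rw [lin_add, lin_smul, lin_smul]
    exact add_pos_of_nonneg_of_pos (mul_nonneg (hy j).le (hx i hi))
      (mul_pos (neg_pos.2 hxj) (hy i))

/-- Points with prescribed value under one support form and large values under the others. -/
lemma exists_lin_eq_forall_ne_le {j : Fin s} (hprim : Finset.univ.gcd (σ j) = 1)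
    (hw : ∃ w, lin (σ j) w = 0 ∧ ∀ i, i ≠ j → 0 < lin (σ i) w) (c : ℤ) (B : Fin s → ℤ) :
    ∃ z, lin (σ j) z = c ∧ ∀ i, i ≠ j → B i ≤ lin (σ i) z := by
  obtain ⟨u, hu⟩ := exists_lin_eq_one hprim
  obtain ⟨w, hwj, hw⟩ := hw
  set N : ℤ := ∑ i, |B i - lin (σ i) (c • u)| with hN
  refine ⟨c • u + N • w, ?_, fun i hi => ?_⟩
  · rw [lin_add, lin_smul, lin_smul, hu, hwj]
    ring
  · have hle : |B i - lin (σ i) (c • u)| ≤ N :=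
      Finset.single_le_sum (f := fun i => |B i - lin (σ i) (c • u)|)
        (fun _ _ => abs_nonneg _) (Finset.mem_univ i)
    have h0 : 0 ≤ N := (abs_nonneg _).trans hle
    have h1 := hw i hi
    have h2 := le_abs_self (B i - lin (σ i) (c • u))
    rw [lin_add, lin_smul (σ i) w]
    nlinarith

lemma regularMod_singleton_of_disjoint
    (hrep : ∀ x : Fin r → ℤ, x ∈ S ↔ ∀ i, 0 ≤ lin (σ i) x) {x y : S}
    (h : ∀ j, lin (σ j) x = 0 ∨ lin (σ j) y = 0) : RegularMod {x} y := by
  rintro z ⟨w, hw, t, ht⟩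
  rw [Set.mem_singleton_iff.1 hw] at ht
  have hmem : (z : Fin r → ℤ) - x ∈ S := by
    refine (hrep _).2 fun j => ?_
    have hz := (hrep z).1 z.2 j
    have ht' := (hrep t).1 t.2 j
    have hval := congrArg (fun w : S => lin (σ j) w) ht
    simp only [AddSubmonoid.coe_add, lin_add] at hval
    rw [lin_sub]
    rcases h j with h | h <;> omega
  exact ⟨x, rfl, ⟨_, hmem⟩, Subtype.ext (by simp)⟩

lemma disjoint_of_regularMod_singleton
    (hrep : ∀ x : Fin r → ℤ, x ∈ S ↔ ∀ i, 0 ≤ lin (σ i) x) {j : Fin s}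
    (hprim : Finset.univ.gcd (σ j) = 1)
    (hw : ∃ w, lin (σ j) w = 0 ∧ ∀ i, i ≠ j → 0 < lin (σ i) w) {x y : S}
    (h : RegularMod {x} y) : lin (σ j) x = 0 ∨ lin (σ j) y = 0 := by
  by_contra! hne
  have hx := (hrep x).1 x.2
  have hy := (hrep y).1 y.2
  obtain ⟨z, hzj, hz⟩ := exists_lin_eq_forall_ne_le hprim hw (lin (σ j) x - 1)
    (fun i => lin (σ i) x)
  have hxj := hx j
  have hyj := hy j
  have hzS : z ∈ S := (hrep z).2 fun i => by
    by_cases hi : i = j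
    · subst hi
      omega
    · exact (hx i).trans (hz i hi)
  have htS : (y : Fin r → ℤ) + z - x ∈ S := (hrep _).2 fun i => by
    rw [lin_sub, lin_add]
    by_cases hi : i = j
    · subst hi
      omega
    · linarith [hz i hi, hy i]
  obtain ⟨_, rfl, t, ht⟩ := h ⟨z, hzS⟩ ⟨x, rfl, ⟨_, htS⟩, Subtype.ext (by simp)⟩
  have hval := congrArg (fun w : S => lin (σ j) w) ht
  simp only [AddSubmonoid.coe_add, lin_add] at hval
  have := (hrep t).1 t.2 j
  omega

/-- The sum of the support forms is a strictly increasing degree function on `S`. -/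
lemma sum_lin_toNat_lt (hSpos : ∀ x ∈ S, -x ∈ S → x = 0)
    (hrep : ∀ x : Fin r → ℤ, x ∈ S ↔ ∀ i, 0 ≤ lin (σ i) x) {x : S} (hx : x ≠ 0) (z : S) :
    (∑ i, lin (σ i) z).toNat < (∑ i, lin (σ i) ↑(x + z)).toNat := by
  have hz : 0 ≤ ∑ i, lin (σ i) z := Finset.sum_nonneg fun i _ => (hrep z).1 z.2 i
  have hpos : 0 < ∑ i, lin (σ i) x := by
    have hnn := (hrep x).1 x.2
    refine (Finset.sum_nonneg fun i _ => hnn i).lt_of_ne fun h => hx (Subtype.ext ?_)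
    rw [eq_comm, Finset.sum_eq_zero_iff_of_nonneg fun i _ => hnn i] at h
    exact eq_zero_of_forall_lin_eq_zero hSpos hrep fun i => h i (Finset.mem_univ i)
  simp only [AddSubmonoid.coe_add, lin_add, Finset.sum_add_distrib]
  omega

lemma sum_intCast_mul (f x : Fin r → ℤ) : ∑ k, (f k : ℝ) * (x k : ℝ) = (lin f x : ℝ) := by
  simp [lin]

lemma intCast_mem_coneOf {x : Fin r → ℤ} (hx : x ∈ S) :
    (fun k => (x k : ℝ)) ∈ coneOf (S : Set (Fin r → ℤ)) :=
  ⟨{x}, fun _ => 1, by simpa using hx, fun _ => zero_le_one, by simp⟩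

/-- A set of facets has a nonzero common point if and only if some nonzero element of `S` lies
on all of them. -/
lemma biInter_facets_ne_singleton_zero_iff
    (hSgp : ∀ x : Fin r → ℤ, ∃ a ∈ S, ∃ b ∈ S, x = a - b)
    (hrep : ∀ x : Fin r → ℤ, x ∈ S ↔ ∀ i, 0 ≤ lin (σ i) x) (T : Finset (Fin s)) :
    (⋂ j ∈ T, {x ∈ coneOf (S : Set (Fin r → ℤ)) | ∑ k, (σ j k : ℝ) * x k = 0}) ≠ {0} ↔
      ∃ x ∈ S, x ≠ 0 ∧ ∀ j ∈ T, lin (σ j) x = 0 := by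
  constructor
  · intro h
    rcases T.eq_empty_or_nonempty with rfl | ⟨j₀, hj₀⟩
    · by_contra! hcon
      have hS : ∀ x ∈ S, x = 0 := fun x hx => by
        by_contra hne
        obtain ⟨j, hj, -⟩ := hcon x hx hne
        simp at hj
      have hall (x : Fin r → ℤ) : x = 0 := by
        obtain ⟨a, ha, b, hb, rfl⟩ := hSgp x
        rw [hS a ha, hS b hb, sub_zero]
      apply h
      have hr (k : Fin r) : False := by
        simpa using congrFun (hall 1) k
      ext x
      simp only [Finset.notMem_empty, Set.iInter_of_empty, Set.iInter_univ, Set.mem_univ,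
        Set.mem_singleton_iff, true_iff]
      exact funext fun k => (hr k).elim
    · by_contra! hcon
      apply h
      ext x
      simp only [Set.mem_iInter, Set.mem_singleton_iff]
      constructor
      · intro hx
        obtain ⟨t, c, ht, hc, rfl⟩ := (hx j₀ hj₀).1
        refine Finset.sum_eq_zero fun v hv => ?_
        have hzero (j) (hj : j ∈ T) : c v * (lin (σ j) v : ℝ) = 0 := by
          have h0 : ∑ v ∈ t, c v * (lin (σ j) v : ℝ) = 0 := by
            rw [← (hx j hj).2]
            simp only [← sum_intCast_mul, Finset.sum_apply, Pi.smul_apply, smul_eq_mul,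
              Finset.mul_sum]
            rw [Finset.sum_comm]
            exact Finset.sum_congr rfl fun _ _ => Finset.sum_congr rfl fun _ _ => by ring
          refine (Finset.sum_eq_zero_iff_of_nonneg fun u hu => ?_).1 h0 v hv
          exact mul_nonneg (hc u) (by exact_mod_cast (hrep u).1 (ht hu) j)
        by_cases hcv : c v = 0
        · simp [hcv]
        · have hv0 : v = 0 := by
            by_contra hne
            obtain ⟨j, hj, hjv⟩ := hcon v (ht hv) hne
            rcases mul_eq_zero.1 (hzero j hj) with h | h
            · exact hcv h
            · exact hjv (by exact_mod_cast h)
          subst hv0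
          ext k
          simp
      · rintro rfl j hj
        refine ⟨⟨∅, 0, by simp, fun _ => le_rfl, by simp⟩, by simp⟩
  · rintro ⟨x, hx, hx0, hxT⟩ h
    have hmem : (fun k => (x k : ℝ)) ∈
        (⋂ j ∈ T, {x ∈ coneOf (S : Set (Fin r → ℤ)) | ∑ k, (σ j k : ℝ) * x k = 0}) := by
      simp only [Set.mem_iInter]
      exact fun j hj => ⟨intCast_mem_coneOf hx, by rw [sum_intCast_mul, hxT j hj, Int.cast_zero]⟩
    rw [h, Set.mem_singleton_iff] at hmem
    exact hx0 (funext fun k => by simpa using congrFun hmem k)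

end Forms

/-- Proposition: combinatorial description of `λ`.
The maximal length `λ` of a regular sequence of (nonunit) monomials on `R = K[S]` equals
the maximal number `ℓ` of subsets `𝓕_1, …, 𝓕_ℓ` of the set of facets of `C(S)` that are
pairwise disjoint and such that for each `i` the intersection of the facets *not* in `𝓕_i`
is different from `{0}`; here the facet `F_j = C(S) ∩ {x : σ_j(x) = 0}`. -/
theorem monomial_depth_eq_max_facet_families
    {r s : ℕ} (K : Type*) [Field K]
    (S : AddSubmonoid (Fin r → ℤ)) (σ : Fin s → Fin r → ℤ)
    (hSfg : S.FG)
    (hSpos : ∀ x ∈ S, -x ∈ S → x = 0)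
    (hSgp : ∀ x : Fin r → ℤ, ∃ a ∈ S, ∃ b ∈ S, x = a - b)
    (hrep : ∀ x : Fin r → ℤ, x ∈ S ↔ ∀ i, 0 ≤ lin (σ i) x)
    (hirr : ∀ j, ∃ x : Fin r → ℤ, lin (σ j) x < 0 ∧ ∀ i, i ≠ j → 0 ≤ lin (σ i) x)
    (hprim : ∀ i, Finset.univ.gcd (σ i) = 1)
    (lam : ℕ)
    (hlam : IsGreatest {l : ℕ | ∃ rs : List ↥(semigroupRing K S), rs.length = l ∧
      (∀ f ∈ rs, ∃ x ∈ S, x ≠ 0 ∧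
        (f : AddMonoidAlgebra K (Fin r → ℤ)) = mono K x) ∧
      RingTheory.Sequence.IsRegular ↥(semigroupRing K S) rs} lam) :
    IsGreatest {l : ℕ | ∃ 𝓕 : Fin l → Finset (Fin s),
      (∀ i j, i ≠ j → Disjoint (𝓕 i) (𝓕 j)) ∧
      ∀ i, (⋂ j ∈ Finset.univ \ 𝓕 i,
        {x ∈ coneOf (S : Set (Fin r → ℤ)) | ∑ k, (σ j k : ℝ) * x k = 0}) ≠ {0}} lam := by
  have hint := exists_forall_lin_pos hSgp hrep hprim
  have hpair {x y : S} : RegularMod {x} y ↔ ∀ j, lin (σ j) x = 0 ∨ lin (σ j) y = 0 :=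
    ⟨fun h j => disjoint_of_regularMod_singleton hrep (hprim j)
      (exists_lin_eq_zero_forall_ne_pos hint (hirr j)) h,
      regularMod_singleton_of_disjoint hrep⟩
  have hreg {L : List S} (hL : ∀ x ∈ L, x ≠ 0) :
      RingTheory.Sequence.IsRegular (semigroupRing K S) (L.map (semigroupMono K)) ↔
        L.Pairwise fun x y : S => ∀ j, lin (σ j) x = 0 ∨ lin (σ j) y = 0 := by
    simp only [isRegular_map_semigroupMono_iff hSpos hL, ← hpair]
    exact ⟨fun h => h.pairwise (fun z : S => (∑ i, lin (σ i) z).toNat)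
      fun x hx => sum_lin_toNat_lt hSpos hrep (hL x hx),
      regularSeqMod_of_pairwise (by simp)⟩
  convert hlam using 1
  ext l
  simp only [biInter_facets_ne_singleton_zero_iff hSgp hrep, Set.mem_ofPred_eq]
  constructor
  · rintro ⟨𝓕, hdisj, hne⟩
    choose x hxS hx0 hx using hne
    have hL : ∀ y ∈ List.ofFn fun i => (⟨x i, hxS i⟩ : S), y ≠ 0 := by
      simp only [List.mem_ofFn, forall_exists_index, forall_apply_eq_imp_iff]
      exact fun i h => hx0 i (congrArg Subtype.val h)
    refine ⟨(List.ofFn fun i => (⟨x i, hxS i⟩ : S)).map (semigroupMono K), by simp, ?_,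
      (hreg hL).2 ?_⟩
    · intro f hf
      obtain ⟨y, hy, rfl⟩ := List.mem_map.1 hf
      exact ⟨y, y.2, fun h => hL y hy (Subtype.ext h), rfl⟩
    · rw [List.pairwise_ofFn]
      intro a b hab j
      by_cases hj : j ∈ 𝓕 a
      · exact Or.inr (hx b j (by simpa using Finset.disjoint_left.1 (hdisj a b hab.ne) hj))
      · exact Or.inl (hx a j (by simpa using hj))
  · rintro ⟨rs, rfl, hmono, hrs⟩
    choose! x hxS hx0 hx using hmono
    obtain ⟨L, rfl, hL⟩ : ∃ L : List S, L.map (semigroupMono K) = rs ∧ ∀ y ∈ L, y ≠ 0 := by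
      refine ⟨rs.attach.map fun f : {f // f ∈ rs} => ⟨x f, hxS f f.2⟩, ?_, ?_⟩
      · rw [List.map_map]
        conv_rhs => rw [← List.attach_map_subtype_val rs]
        exact List.map_congr_left fun (f : {f // f ∈ rs}) _ => Subtype.ext (hx f f.2).symm
      · intro y hy h
        obtain ⟨f, -, rfl⟩ := List.mem_map.1 hy
        exact hx0 f f.2 (congrArg Subtype.val h)
    rw [hreg hL] at hrs
    rw [List.length_map]
    refine ⟨fun i => Finset.univ.filter fun j => lin (σ j) L[i] ≠ 0, fun a b hab => ?_,
      fun i => ⟨L[i], L[i].2, fun h => hL _ (List.getElem_mem i.2) (Subtype.ext h), by simp⟩⟩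
    rw [Finset.disjoint_left]
    simp only [Finset.mem_filter, Finset.mem_univ, true_and, not_not]
    intro j hj
    rw [List.pairwise_iff_getElem] at hrs
    rcases lt_or_gt_of_ne hab with h | h
    · exact (hrs a b a.2 b.2 h j).resolve_left hj
    · exact (hrs b a b.2 a.2 h j).resolve_right hj
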